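/- For every ε with 0 < ε ≤ 1/2 there exists a constant C₁ > 0 such that for all integers k ≥ 4, d ≥ 24 with d ≥ C₁·k and all n ≥ 2·k·d·⌈log₂ d⌉, there exists a Boolean function f : (Fin n → Bool) → Bool that is computed exactly by some quantum k-OBDD of width d² with the natural (identity) order, but is not computed with error at most 1/2 − ε by any quantum k-OBDD of width ⌊√(d/(C₁·k))⌋ with the natural (identity) order. -/

import Mathlib

/-- The bit read at step `t` by an OBDD with variable order `π` on input `x`:
at step `t` the variable `x (π (t mod n))` is read. -/
def readBit {n : ℕ} (π : Equiv.Perm (Fin n)) (x : Fin n → Bool) (t : ℕ) : Bool :=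
  if h : 0 < n then x (π ⟨t % n, Nat.mod_lt t h⟩) else false

/-- The state vector of a quantum (k-)OBDD with order `π`, initial vector `ψ0` and
unitary transition matrices `G` after `t` steps on input `x`. -/
noncomputable def quantState {n w : ℕ} (π : Equiv.Perm (Fin n)) (ψ0 : Fin w → ℂ)
    (G : ℕ → Bool → Matrix (Fin w) (Fin w) ℂ) (x : Fin n → Bool) : ℕ → Fin w → ℂ
  | 0 => ψ0
  | t + 1 => Matrix.mulVec (G t (readBit π x t)) (quantState π ψ0 G x t)

/-- `f` is computed with error at most `1/2 - ε` by some quantum `k`-OBDD of width `w`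
on `n` variables with the fixed order `π`. -/
def quantComputes (k w n : ℕ) (π : Equiv.Perm (Fin n)) (ε : ℝ)
    (f : (Fin n → Bool) → Bool) : Prop :=
  ∃ (ψ0 : Fin w → ℂ) (G : ℕ → Bool → Matrix (Fin w) (Fin w) ℂ) (A : Finset (Fin w)),
    (∑ i, Complex.normSq (ψ0 i)) = 1 ∧
    (∀ j b, G j b ∈ Matrix.unitaryGroup (Fin w) ℂ) ∧
    (∀ x, f x = true →
      1 / 2 + ε ≤ ∑ i ∈ A, Complex.normSq (quantState π ψ0 G x (k * n) i)) ∧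
    (∀ x, f x = false →
      ∑ i ∈ A, Complex.normSq (quantState π ψ0 G x (k * n) i) ≤ 1 / 2 - ε)

/-- `f` is computed exactly by some quantum `k`-OBDD of width `w` on `n` variables
with the fixed order `π`: acceptance probability `1` on `f⁻¹(1)` and `0` on `f⁻¹(0)`. -/
def quantComputesExactly (k w n : ℕ) (π : Equiv.Perm (Fin n))
    (f : (Fin n → Bool) → Bool) : Prop :=
  ∃ (ψ0 : Fin w → ℂ) (G : ℕ → Bool → Matrix (Fin w) (Fin w) ℂ) (A : Finset (Fin w)),
    (∑ i, Complex.normSq (ψ0 i)) = 1 ∧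
    (∀ j b, G j b ∈ Matrix.unitaryGroup (Fin w) ℂ) ∧
    (∀ x, f x = true →
      ∑ i ∈ A, Complex.normSq (quantState π ψ0 G x (k * n) i) = 1) ∧
    (∀ x, f x = false →
      ∑ i ∈ A, Complex.normSq (quantState π ψ0 G x (k * n) i) = 0)

/-! ### Upper bound: simulation of a reversible automaton -/

/-- The state of a reversible automaton after `t` steps. -/
def revRun {S : Type} {n : ℕ} (σ : ℕ → Bool → Equiv.Perm S) (s0 : S) (x : Fin n → Bool) : ℕ → S
  | 0 => s0
  | t + 1 => σ t (readBit (Equiv.refl (Fin n)) x t) (revRun σ s0 x t)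

/-- The matrix of a permutation. -/
def permMat {W : ℕ} (τ : Equiv.Perm (Fin W)) : Matrix (Fin W) (Fin W) ℂ :=
  Matrix.of fun i j => if i = τ j then 1 else 0

lemma permMat_unitary {W : ℕ} (τ : Equiv.Perm (Fin W)) :
    permMat τ ∈ Matrix.unitaryGroup (Fin W) ℂ := by
  rw [Matrix.mem_unitaryGroup_iff']
  ext i j
  simp [permMat, Matrix.mul_apply, Matrix.star_apply, Matrix.one_apply, apply_ite, eq_comm]

lemma permMat_mulVec {W : ℕ} (τ : Equiv.Perm (Fin W)) (j : Fin W) :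
    (permMat τ).mulVec (Pi.single j 1) = Pi.single (τ j) 1 := by
  rw [Matrix.mulVec_single_one]
  ext i
  simp [permMat, Matrix.col_apply, Pi.single_apply]

lemma exact_of_reversible {S : Type} [Fintype S] [DecidableEq S] {k W n : ℕ}
    (hc : Fintype.card S ≤ W) (σ : ℕ → Bool → Equiv.Perm S) (s0 : S) (acc : S → Bool)
    (f : (Fin n → Bool) → Bool) (hf : ∀ x, f x = acc (revRun σ s0 x (k * n))) :
    quantComputesExactly k W n (Equiv.refl (Fin n)) f := by
  obtain ⟨e⟩ : Nonempty (S ↪ Fin W) :=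
    Function.Embedding.nonempty_of_card_le (by simpa using hc)
  classical
  have hst : ∀ x t, quantState (Equiv.refl (Fin n)) (Pi.single (e s0) 1)
      (fun t b => permMat ((σ t b).viaFintypeEmbedding e)) x t
      = Pi.single (e (revRun σ s0 x t)) 1 := by
    intro x t
    induction t with
    | zero => rfl
    | succ t ih =>
      simp only [quantState, ih, permMat_mulVec, revRun,
        Equiv.Perm.viaFintypeEmbedding_apply_image]
  have hsum : ∀ (A : Finset (Fin W)) (j : Fin W),
      ∑ i ∈ A, Complex.normSq ((Pi.single j 1 : Fin W → ℂ) i) = if j ∈ A then 1 else 0 := by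
    intro A j
    simp [Pi.single_apply, apply_ite]
  refine ⟨Pi.single (e s0) 1, fun t b => permMat ((σ t b).viaFintypeEmbedding e),
    Finset.univ.filter (fun i => ∃ s, e s = i ∧ acc s = true), ?_, ?_, ?_, ?_⟩
  · rw [hsum]; simp
  · intro j b; exact permMat_unitary _
  · intro x hx
    rw [hst, hsum, if_pos]
    simp only [Finset.mem_filter, Finset.mem_univ, true_and]
    exact ⟨_, rfl, by rw [← hf, hx]⟩
  · intro x hx
    rw [hst, hsum, if_neg]
    simp only [Finset.mem_filter, Finset.mem_univ, true_and]
    rintro ⟨s, hs, hacc⟩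
    rw [e.injective hs, ← hf, hx] at hacc
    exact Bool.false_ne_true hacc

/-- A bit as an element of `ZMod 2`. -/
def bz (c : Bool) : ZMod 2 := if c then 1 else 0

/-- The basic reversible step: add `c • u` to the register and the product with `v` to the
accumulator. -/
def shear {b : ℕ} (u v : Fin b → ZMod 2) (c : ZMod 2) :
    Equiv.Perm ((Fin b → ZMod 2) × ZMod 2) where
  toFun s := (fun j => s.1 j + c * u j, s.2 + ∑ j, c * v j * s.1 j)
  invFun s := (fun j => s.1 j - c * u j, s.2 - ∑ j, c * v j * (s.1 j - c * u j))
  left_inv s := by ext <;> simp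
  right_inv s := by ext <;> simp

/-- Register update vector in pass `i` at variable `v`. -/
def uVec (b i v : ℕ) (j : Fin b) : ZMod 2 :=
  (if 1 ≤ i ∧ v + b = i * b + j then 1 else 0) + (if v = i * b + j then 1 else 0)

/-- Accumulator update vector in pass `i` at variable `v`. -/
def vVec (b p i v : ℕ) (j : Fin b) : ZMod 2 :=
  if v = p + i * b + j then 1 else 0

/-- The automaton computing the inner product. -/
def ipStep (b p n : ℕ) (t : ℕ) (c : Bool) : Equiv.Perm ((Fin b → ZMod 2) × ZMod 2) :=
  shear (uVec b (t / n) (t % n)) (vVec b p (t / n) (t % n)) (bz c)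

/-- value of variable `v` as an element of `ZMod 2`. -/
def vz {n : ℕ} (x : Fin n → Bool) (v : ℕ) : ZMod 2 := bz (readBit (Equiv.refl (Fin n)) x v)

/-- The inner product function. -/
def ipFun (p n : ℕ) (x : Fin n → Bool) : Bool :=
  decide (∑ q ∈ Finset.range p, vz x q * vz x (p + q) = 1)

lemma readBit_pass {n : ℕ} (x : Fin n → Bool) (i v : ℕ) :
    readBit (Equiv.refl (Fin n)) x (i * n + v) = readBit (Equiv.refl (Fin n)) x v := by
  unfold readBit
  simp

/-- Predicted register contents. -/
def regPred {n : ℕ} (b : ℕ) (x : Fin n → Bool) (i v : ℕ) (j : Fin b) : ZMod 2 :=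
  (if 1 ≤ i ∧ v + b ≤ i * b + j then vz x (i * b + j - b) else 0) +
    (if i * b + j < v then vz x (i * b + j) else 0)

/-- Predicted accumulator contents. -/
def accPred {n : ℕ} (b p : ℕ) (x : Fin n → Bool) (i v : ℕ) : ZMod 2 :=
  (∑ q ∈ Finset.range (i * b), vz x q * vz x (p + q)) +
    ∑ j : Fin b, if p + i * b + j < v then vz x (i * b + j) * vz x (p + i * b + j) else 0

lemma ip_pass {n b k : ℕ} (hn : 2 * (k * b) ≤ n) (x : Fin n → Bool) (i : ℕ) (hi : i < k)
    (h0 : revRun (ipStep b (k * b) n) (0, 0) x (i * n) =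
      (regPred b x i 0, accPred b (k * b) x i 0)) (v : ℕ) (hv : v ≤ n) :
    revRun (ipStep b (k * b) n) (0, 0) x (i * n + v) =
      (regPred b x i v, accPred b (k * b) x i v) := by
  have hib : i * b + b ≤ k * b := by
    have := Nat.mul_le_mul_right b (Nat.succ_le_of_lt hi)
    rwa [Nat.succ_mul] at this
  have hib' : 1 ≤ i → b ≤ i * b := fun h => Nat.le_mul_of_pos_left b h
  induction v with
  | zero => simpa using h0
  | succ v ih =>
    have ih := ih (by omega)
    have hvn : v < n := by omega
    have hd : (i * n + v) / n = i := by
      rw [mul_comm, Nat.mul_add_div (by omega), Nat.div_eq_of_lt hvn, add_zero]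
    have hm : (i * n + v) % n = v := by
      rw [Nat.mul_add_mod', Nat.mod_eq_of_lt hvn]
    rw [← add_assoc]
    simp only [revRun, ih, readBit_pass]
    have hc : bz (readBit (Equiv.refl (Fin n)) x v) = vz x v := rfl
    simp only [ipStep, hd, hm, shear, Equiv.coe_fn_mk, hc]
    have two : ∀ z : ZMod 2, z + z = 0 := by decide
    clear ih h0
    refine Prod.ext ?_ ?_
    · funext j
      simp only [regPred, uVec]
      generalize i * b = B at *
      generalize k * b = P at *
      have hj := j.2
      by_cases c1 : 1 ≤ i ∧ v + b = B + j
      · have hbB := hib' c1.1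
        have e : B + j - b = v := by omega
        rw [if_pos (by omega), if_neg (by omega), if_pos c1, if_neg (by omega),
          if_neg (by omega), if_neg (by omega), e]
        simp [two]
      · by_cases c2 : v = B + j
        · rw [if_neg (by omega), if_neg (by omega), if_neg c1, if_pos c2,
            if_neg (by omega), if_pos (by omega), ← c2]
          simp
        · rw [if_neg c1, if_neg c2]
          have e1 : (1 ≤ i ∧ v + b ≤ B + j) ↔ (1 ≤ i ∧ v + 1 + b ≤ B + j) := by omega
          have e2 : (B + j < v) ↔ (B + j < v + 1) := by omega
          simp only [e1, e2]
          simp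
    · simp only [accPred, regPred, vVec, add_assoc]
      generalize i * b = B at *
      generalize k * b = P at *
      congr 1
      rw [← Finset.sum_add_distrib]
      refine Finset.sum_congr rfl fun j _ => ?_
      have hj := j.2
      by_cases c1 : v = P + (B + j)
      · rw [if_neg (by omega), if_pos c1, if_neg (by omega), if_pos (by omega), if_pos (by omega)]
        rw [← c1]
        ring
      · rw [if_neg c1]
        have e2 : (P + (B + j) < v) ↔ (P + (B + j) < v + 1) := by omega
        simp only [e2]
        simp

lemma ip_run {n b k : ℕ} (hn : 2 * (k * b) ≤ n) (x : Fin n → Bool) (i : ℕ) (hi : i ≤ k) :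
    revRun (ipStep b (k * b) n) (0, 0) x (i * n) =
      (regPred b x i 0, accPred b (k * b) x i 0) := by
  induction i with
  | zero =>
    simp only [zero_mul, revRun]
    refine Prod.ext ?_ ?_
    · funext j; simp [regPred]
    · simp [accPred]
  | succ i ih =>
    have h := ip_pass hn x i (by omega) (ih (by omega)) n le_rfl
    have hib : i * b + b ≤ k * b := by
      have := Nat.mul_le_mul_right b (Nat.succ_le_of_lt hi)
      rwa [Nat.succ_mul] at this
    rw [Nat.succ_mul, h]
    refine Prod.ext ?_ ?_
    · funext j
      have hj := j.2
      simp only [regPred, Nat.succ_mul]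
      rw [if_neg (by omega), if_pos (by omega), if_pos (by omega), if_neg (by omega), zero_add,
        add_zero]
      congr 1
      omega
    · simp only [accPred, Nat.succ_mul, Finset.sum_range_add]
      rw [add_assoc]
      congr 1
      rw [← Fin.sum_univ_eq_sum_range (fun j => vz x (i * b + j) * vz x (k * b + (i * b + j)))]
      rw [← Finset.sum_add_distrib]
      refine Finset.sum_congr rfl fun j _ => ?_
      have hj := j.2
      rw [if_pos (by omega), if_neg (by omega), add_zero, add_assoc]

lemma ip_upper {n b k W : ℕ} (hn : 2 * (k * b) ≤ n) (hW : 2 ^ (b + 1) ≤ W) :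
    quantComputesExactly k W n (Equiv.refl (Fin n)) (ipFun (k * b) n) := by
  refine exact_of_reversible (S := (Fin b → ZMod 2) × ZMod 2) ?_ (ipStep b (k * b) n) (0, 0)
    (fun s => decide (s.2 = 1)) _ ?_
  · simpa [ZMod.card, pow_succ] using hW
  · intro x
    rw [ip_run hn x k le_rfl]
    simp [ipFun, accPred]

/-! ### Lower bound -/

/-- Product of transition matrices over the steps `t0, …, t0 + len - 1`. -/
def prodM {w : ℕ} (G : ℕ → Bool → Matrix (Fin w) (Fin w) ℂ) (β : ℕ → Bool) (t0 : ℕ) :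
    ℕ → Matrix (Fin w) (Fin w) ℂ
  | 0 => 1
  | l + 1 => G (t0 + l) (β (t0 + l)) * prodM G β t0 l

lemma prodM_unitary {w : ℕ} {G : ℕ → Bool → Matrix (Fin w) (Fin w) ℂ}
    (hG : ∀ j b, G j b ∈ Matrix.unitaryGroup (Fin w) ℂ) (β : ℕ → Bool) (t0 l : ℕ) :
    prodM G β t0 l ∈ Matrix.unitaryGroup (Fin w) ℂ := by
  induction l with
  | zero => exact one_mem _
  | succ l ih => exact mul_mem (hG _ _) ih

lemma prodM_congr {w : ℕ} (G : ℕ → Bool → Matrix (Fin w) (Fin w) ℂ) (β β' : ℕ → Bool)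
    (t0 l : ℕ) (h : ∀ u < l, β (t0 + u) = β' (t0 + u)) : prodM G β t0 l = prodM G β' t0 l := by
  induction l with
  | zero => rfl
  | succ l ih =>
    simp only [prodM]
    rw [h l (by omega), ih fun u hu => h u (by omega)]

lemma quantState_add {n w : ℕ} (ψ0 : Fin w → ℂ) (G : ℕ → Bool → Matrix (Fin w) (Fin w) ℂ)
    (z : Fin n → Bool) (t0 l : ℕ) :
    quantState (Equiv.refl (Fin n)) ψ0 G z (t0 + l) =
      (prodM G (readBit (Equiv.refl (Fin n)) z) t0 l).mulVec
        (quantState (Equiv.refl (Fin n)) ψ0 G z t0) := by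
  induction l with
  | zero => simp [prodM]
  | succ l ih =>
    rw [← add_assoc]
    simp only [quantState, prodM, ih, Matrix.mulVec_mulVec]

/-- The input with first part `x` and second part `y`. -/
def glue (p n : ℕ) (x y : Fin p → Bool) (v : Fin n) : Bool :=
  if h : v.1 < p then x ⟨v.1, h⟩ else if h : v.1 - p < p then y ⟨v.1 - p, h⟩ else false

lemma unitary_col {w : ℕ} {U : Matrix (Fin w) (Fin w) ℂ}
    (hU : U ∈ Matrix.unitaryGroup (Fin w) ℂ) (i : Fin w) :
    ∑ j, Complex.normSq (U j i) = 1 := by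
  have h := congrFun (congrFun (Matrix.mem_unitaryGroup_iff'.1 hU) i) i
  simp only [Matrix.mul_apply, Matrix.star_apply, Matrix.one_apply_eq] at h
  have h2 : ∀ j, star (U j i) * U j i = ((Complex.normSq (U j i) : ℝ) : ℂ) := by
    intro j; rw [Complex.normSq_eq_conj_mul_self]; rfl
  simp only [h2] at h
  exact_mod_cast h

lemma unitary_mulVec {w : ℕ} {U : Matrix (Fin w) (Fin w) ℂ}
    (hU : U ∈ Matrix.unitaryGroup (Fin w) ℂ) (ψ : Fin w → ℂ) :
    ∑ j, Complex.normSq (U.mulVec ψ j) = ∑ j, Complex.normSq (ψ j) := by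
  have key : ∀ φ : Fin w → ℂ, ((∑ j, Complex.normSq (φ j) : ℝ) : ℂ) = dotProduct (star φ) φ := by
    intro φ
    push_cast
    refine Finset.sum_congr rfl fun j _ => ?_
    rw [Complex.normSq_eq_conj_mul_self]; rfl
  have : ((∑ j, Complex.normSq (U.mulVec ψ j) : ℝ) : ℂ) = ((∑ j, Complex.normSq (ψ j) : ℝ) : ℂ) := by
    rw [key, key, Matrix.star_mulVec, Matrix.dotProduct_mulVec, Matrix.vecMul_vecMul,
      ← Matrix.star_eq_conjTranspose, Matrix.mem_unitaryGroup_iff'.1 hU, Matrix.vecMul_one]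
  exact_mod_cast this

/-- A factorization of bounded size of a vector valued function of two arguments. -/
def Fac {X Y I : Type} [Fintype I] (φ : X → Y → I → ℂ) (α : ℝ) : Prop :=
  ∃ (S : Type) (_ : Fintype S) (a : X → I → S → ℂ) (b : Y → I → S → ℂ),
    (∀ x y i, φ x y i = ∑ s, a x i s * b y i s) ∧
    (∀ x, ∑ i, ∑ s, Complex.normSq (a x i s) ≤ α) ∧
    (∀ y, ∑ i, ∑ s, Complex.normSq (b y i s) ≤ α)

lemma Fac.base {X Y : Type} {w : ℕ} (U : X → Matrix (Fin w) (Fin w) ℂ)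
    (V : Y → Matrix (Fin w) (Fin w) ℂ) (hU : ∀ x, U x ∈ Matrix.unitaryGroup (Fin w) ℂ)
    (hV : ∀ y, V y ∈ Matrix.unitaryGroup (Fin w) ℂ) (ψ : Fin w → ℂ)
    (hψ : ∑ i, Complex.normSq (ψ i) = 1) :
    Fac (fun x y => (V y).mulVec ((U x).mulVec ψ)) (w : ℝ) := by
  refine ⟨Fin w, inferInstance, fun x _ i => (U x).mulVec ψ i, fun y j i => V y j i, ?_, ?_, ?_⟩
  · intro x y i
    simp only [Matrix.mulVec, dotProduct]
    exact Finset.sum_congr rfl fun j _ => mul_comm _ _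
  · intro x
    simp [unitary_mulVec (hU x), hψ]
  · intro y
    rw [Finset.sum_comm]
    simp [unitary_col (hV y)]

lemma Fac.step {X Y : Type} {w : ℕ} {φ : X → Y → Fin w → ℂ} {α : ℝ} (h : Fac φ α)
    (U : X → Matrix (Fin w) (Fin w) ℂ)
    (V : Y → Matrix (Fin w) (Fin w) ℂ) (hU : ∀ x, U x ∈ Matrix.unitaryGroup (Fin w) ℂ)
    (hV : ∀ y, V y ∈ Matrix.unitaryGroup (Fin w) ℂ) :
    Fac (fun x y => (V y).mulVec ((U x).mulVec (φ x y))) (w * α) := by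
  obtain ⟨S, _, a, b, hφ, ha, hb⟩ := h
  refine ⟨Fin w × Fin w × S, inferInstance, fun x _ t => U x t.1 t.2.1 * a x t.2.1 t.2.2,
    fun y k t => V y k t.1 * b y t.2.1 t.2.2, ?_, ?_, ?_⟩
  · intro x y k
    simp only [Matrix.mulVec, dotProduct, hφ, Fintype.sum_prod_type, Finset.mul_sum]
    refine Finset.sum_congr rfl fun _ _ => Finset.sum_congr rfl fun _ _ =>
      Finset.sum_congr rfl fun _ _ => by ring
  · intro x
    simp only [Fintype.sum_prod_type, Complex.normSq_mul, Finset.sum_const, Finset.card_univ,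
      Fintype.card_fin, nsmul_eq_mul]
    refine mul_le_mul_of_nonneg_left ?_ (Nat.cast_nonneg w)
    rw [Finset.sum_comm]
    simp only [← Finset.mul_sum, ← Finset.sum_mul, unitary_col (hU x), one_mul]
    exact ha x
  · intro y
    simp only [Fintype.sum_prod_type, Complex.normSq_mul, ← Finset.mul_sum, ← Finset.sum_mul]
    rw [Finset.sum_comm]
    simp only [unitary_col (hV y), Finset.sum_const, Finset.card_univ,
      Fintype.card_fin, nsmul_eq_mul, mul_one]
    exact mul_le_mul_of_nonneg_left (hb y) (Nat.cast_nonneg w)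

lemma Fac.prob {X Y : Type} {w : ℕ} {φ : X → Y → Fin w → ℂ} {α : ℝ} (h : Fac φ α)
    (A : Finset (Fin w)) :
    Fac (fun x y (_ : Unit) => ((∑ i ∈ A, Complex.normSq (φ x y i) : ℝ) : ℂ)) (α ^ 2) := by
  classical
  obtain ⟨S, _, a, b, hφ, ha, hb⟩ := h
  have sq : ∀ c : Fin w → S → ℝ, (∀ i s, 0 ≤ c i s) → ∑ i, ∑ s, c i s ≤ α →
      ∑ i, ∑ s, ∑ s', c i s * c i s' ≤ α ^ 2 := by
    intro c hc h
    simp only [← Finset.mul_sum, ← Finset.sum_mul, ← pow_two]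
    have h0 : ∀ i ∈ Finset.univ, 0 ≤ ∑ s, c i s := fun i _ => Finset.sum_nonneg fun s _ => hc i s
    refine (Finset.sum_sq_le_sq_sum_of_nonneg h0).trans ?_
    exact pow_le_pow_left₀ (Finset.sum_nonneg h0) h 2
  refine ⟨Fin w × S × S, inferInstance,
    fun x _ t => if t.1 ∈ A then a x t.1 t.2.1 * star (a x t.1 t.2.2) else 0,
    fun y _ t => b y t.1 t.2.1 * star (b y t.1 t.2.2), ?_, ?_, ?_⟩
  · intro x y _
    push_cast
    simp only [Fintype.sum_prod_type]
    rw [← Finset.sum_filter_add_sum_filter_not Finset.univ (fun i => i ∈ A)]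
    rw [Finset.sum_eq_zero (s := Finset.univ.filter (fun i => i ∉ A))]
    · rw [add_zero, Finset.filter_mem_eq_inter, Finset.univ_inter]
      refine Finset.sum_congr rfl fun i hi => ?_
      simp only [hi, if_true]
      rw [← Complex.mul_conj, hφ, map_sum, Finset.sum_mul_sum]
      refine Finset.sum_congr rfl fun _ _ => Finset.sum_congr rfl fun _ _ => ?_
      rw [map_mul]
      simp only [Complex.star_def]
      ring
    · intro i hi
      simp only [Finset.mem_filter] at hi
      simp [hi.2]
  · intro x
    simp only [Finset.univ_unique, Finset.sum_singleton, Fintype.sum_prod_type]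
    refine le_trans ?_ (sq (fun i s => Complex.normSq (a x i s)) (fun _ _ => Complex.normSq_nonneg _)
      (ha x))
    refine Finset.sum_le_sum fun i _ => Finset.sum_le_sum fun s _ => Finset.sum_le_sum fun s' _ => ?_
    split_ifs
    · simp [Complex.normSq_mul]
    · simp only [map_zero]
      exact mul_nonneg (Complex.normSq_nonneg _) (Complex.normSq_nonneg _)
  · intro y
    simp only [Finset.univ_unique, Finset.sum_singleton, Fintype.sum_prod_type]
    refine le_trans (le_of_eq ?_) (sq (fun i s => Complex.normSq (b y i s))
      (fun _ _ => Complex.normSq_nonneg _) (hb y))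
    simp [Complex.normSq_mul]

/-- One entry of the two by two Hadamard matrix. -/
def had1 (c e : Bool) : ℝ := if c && e then -1 else 1

/-- The Hadamard matrix. -/
def had {p : ℕ} (x y : Fin p → Bool) : ℝ := ∏ q, had1 (x q) (y q)

lemma had_orth {p : ℕ} (x x' : Fin p → Bool) :
    ∑ y : Fin p → Bool, had x y * had x' y = if x = x' then 2 ^ p else 0 := by
  simp only [had, ← Finset.prod_mul_distrib]
  rw [← Fintype.prod_sum (fun q c => had1 (x q) c * had1 (x' q) c)]
  have h1 : ∀ c c' : Bool, ∑ e : Bool, had1 c e * had1 c' e = if c = c' then 2 else 0 := by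
    intro c c'
    cases c <;> cases c' <;> simp [had1] <;> norm_num
  simp only [h1]
  split_ifs with h
  · subst h; simp
  · obtain ⟨q, hq⟩ := Function.ne_iff.1 h
    exact Finset.prod_eq_zero (Finset.mem_univ q) (if_neg hq)

lemma had_l2 {p : ℕ} (a : (Fin p → Bool) → ℂ) :
    ∑ y, Complex.normSq (∑ x, (had x y : ℂ) * a x) = 2 ^ p * ∑ x, Complex.normSq (a x) := by
  have : ((∑ y, Complex.normSq (∑ x, (had x y : ℂ) * a x) : ℝ) : ℂ) =
      ((2 ^ p * ∑ x, Complex.normSq (a x) : ℝ) : ℂ) := by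
    push_cast
    simp only [← Complex.mul_conj, map_sum, Finset.sum_mul_sum, map_mul, Complex.conj_ofReal]
    rw [Finset.sum_comm, Finset.mul_sum]
    refine Finset.sum_congr rfl fun x _ => ?_
    rw [Finset.sum_comm]
    have : ∀ x', ∑ y, (had x y : ℂ) * a x * ((had x' y : ℂ) * (starRingEnd ℂ) (a x')) =
        (if x = x' then 2 ^ p else 0) * (a x * (starRingEnd ℂ) (a x')) := by
      intro x'
      have h : ∑ y, (had x y : ℂ) * (had x' y : ℂ) = if x = x' then 2 ^ p else 0 := by
        have h := congrArg (fun r : ℝ => (r : ℂ)) (had_orth x x')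
        split_ifs at h ⊢ <;> simpa using h
      rw [← h, Finset.sum_mul]
      exact Finset.sum_congr rfl fun y _ => by ring
    simp [this]
  exact_mod_cast this

lemma had_bilin {p : ℕ} (a b : (Fin p → Bool) → ℂ) :
    ‖∑ x, ∑ y, (had x y : ℂ) * (a x * b y)‖ ≤
      √(2 ^ p) * ((∑ x, Complex.normSq (a x) + ∑ y, Complex.normSq (b y)) / 2) := by
  have h1 : ∑ x, ∑ y, (had x y : ℂ) * (a x * b y) =
      ∑ y, (∑ x, (had x y : ℂ) * a x) * b y := by
    rw [Finset.sum_comm]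
    refine Finset.sum_congr rfl fun y _ => ?_
    rw [Finset.sum_mul]
    exact Finset.sum_congr rfl fun x _ => by ring
  rw [h1]
  set c := fun y => ∑ x, (had x y : ℂ) * a x with hc
  have hl := had_l2 a
  set r : ℝ := √(2 ^ p) with hr
  have hrpos : 0 < r := Real.sqrt_pos.2 (by positivity)
  have hr2 : r ^ 2 = 2 ^ p := Real.sq_sqrt (by positivity)
  rw [← hr2] at hl
  have h2 : ∀ y, ‖c y * b y‖ ≤ r⁻¹ / 2 * Complex.normSq (c y) + r / 2 * Complex.normSq (b y) := by
    intro y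
    rw [norm_mul, Complex.normSq_eq_norm_sq, Complex.normSq_eq_norm_sq]
    have : r⁻¹ / 2 * ‖c y‖ ^ 2 + r / 2 * ‖b y‖ ^ 2 - ‖c y‖ * ‖b y‖ =
      r⁻¹ / 2 * (‖c y‖ - r * ‖b y‖) ^ 2 := by field_simp; ring
    have h3 : 0 ≤ r⁻¹ / 2 * (‖c y‖ - r * ‖b y‖) ^ 2 := by positivity
    linarith
  refine (norm_sum_le _ _).trans ((Finset.sum_le_sum fun y _ => h2 y).trans (le_of_eq ?_))
  rw [Finset.sum_add_distrib, ← Finset.mul_sum, ← Finset.mul_sum, hl]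
  field_simp

lemma had_fac {p : ℕ} {F : (Fin p → Bool) → (Fin p → Bool) → Unit → ℂ} {α : ℝ} (h : Fac F α) :
    ‖∑ x, ∑ y, (had x y : ℂ) * F x y ()‖ ≤ √(2 ^ p) * (2 ^ p * α) := by
  obtain ⟨S, _, a, b, hφ, ha, hb⟩ := h
  have h1 : ∑ x, ∑ y, (had x y : ℂ) * F x y () =
      ∑ s, ∑ x, ∑ y, (had x y : ℂ) * (a x () s * b y () s) := by
    simp only [hφ, Finset.mul_sum]
    rw [Finset.sum_comm (γ := S)]
    exact Finset.sum_congr rfl fun x _ => Finset.sum_comm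
  rw [h1]
  refine (norm_sum_le _ _).trans ((Finset.sum_le_sum fun s _ => had_bilin _ _).trans ?_)
  rw [← Finset.mul_sum]
  refine mul_le_mul_of_nonneg_left ?_ (Real.sqrt_nonneg _)
  rw [← Finset.sum_div, Finset.sum_add_distrib, Finset.sum_comm (γ := S),
    Finset.sum_comm (γ := S)]
  simp only [Finset.univ_unique, Finset.sum_singleton] at ha hb
  have e1 := Finset.sum_le_sum fun x (_ : x ∈ Finset.univ) => ha x
  have e2 := Finset.sum_le_sum fun x (_ : x ∈ Finset.univ) => hb x
  simp at e1 e2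
  simp
  linarith

lemma had_sum {p : ℕ} :
    |∑ x : Fin p → Bool, ∑ y : Fin p → Bool, had x y| ≤ √(2 ^ p) * 2 ^ p := by
  have h := had_bilin (p := p) (fun _ => 1) (fun _ => 1)
  have e : ∑ x : Fin p → Bool, ∑ y : Fin p → Bool, (had x y : ℂ) * (1 * 1) =
      ((∑ x : Fin p → Bool, ∑ y : Fin p → Bool, had x y : ℝ) : ℂ) := by
    push_cast
    simp
  rw [e, Complex.norm_real] at h
  simpa using h

/-- The state after `i + 1` passes. -/
lemma fac_state {p n w : ℕ} (hn : 2 * p ≤ n) (ψ0 : Fin w → ℂ)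
    (G : ℕ → Bool → Matrix (Fin w) (Fin w) ℂ) (hψ : ∑ i, Complex.normSq (ψ0 i) = 1)
    (hG : ∀ j b, G j b ∈ Matrix.unitaryGroup (Fin w) ℂ) (i : ℕ) :
    Fac (fun x y => quantState (Equiv.refl (Fin n)) ψ0 G (glue p n x y) ((i + 1) * n))
      ((w : ℝ) ^ (i + 1)) := by
  have hpass : ∀ (i : ℕ) (x y : Fin p → Bool),
      quantState (Equiv.refl (Fin n)) ψ0 G (glue p n x y) ((i + 1) * n) =
      (prodM G (readBit (Equiv.refl (Fin n)) (glue p n (fun _ => false) y)) (i * n + p)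
        (n - p)).mulVec
      ((prodM G (readBit (Equiv.refl (Fin n)) (glue p n x (fun _ => false))) (i * n) p).mulVec
      (quantState (Equiv.refl (Fin n)) ψ0 G (glue p n x y) (i * n))) := by
    intro i x y
    have e : (i + 1) * n = i * n + p + (n - p) := by
      rw [Nat.succ_mul]; omega
    rw [e, quantState_add, quantState_add]
    congr 1
    · refine prodM_congr _ _ _ _ _ fun u hu => ?_
      have : (i * n + p + u) % n = p + u := by
        rw [add_assoc, Nat.mul_add_mod', Nat.mod_eq_of_lt (by omega)]
      simp only [readBit, this, glue]
      simp
    · congr 1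
      refine prodM_congr _ _ _ _ _ fun u hu => ?_
      have : (i * n + u) % n = u := by
        rw [Nat.mul_add_mod', Nat.mod_eq_of_lt (by omega)]
      simp only [readBit, this, glue]
      simp [hu]
  induction i with
  | zero =>
    simp only [hpass]
    simpa [quantState] using Fac.base _ _ (fun x => prodM_unitary hG _ _ _)
      (fun x => prodM_unitary hG _ _ _) ψ0 hψ
  | succ i ih =>
    simp only [hpass (i + 1)]
    rw [pow_succ']
    exact Fac.step ih _ _ (fun x => prodM_unitary hG _ _ _) (fun x => prodM_unitary hG _ _ _)

lemma had_ip {p n : ℕ} (hn : 2 * p ≤ n) (x y : Fin p → Bool) :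
    had x y = if ipFun p n (glue p n x y) then -1 else 1 := by
  have hx : ∀ q : Fin p, vz (glue p n x y) q = bz (x q) := by
    intro q
    have hq := q.2
    have : q.1 % n = q.1 := Nat.mod_eq_of_lt (by omega)
    simp [vz, readBit, glue, this, show 0 < n by omega]
  have hy : ∀ q : Fin p, vz (glue p n x y) (p + q) = bz (y q) := by
    intro q
    have hq := q.2
    have : (p + q.1) % n = p + q.1 := Nat.mod_eq_of_lt (by omega)
    simp [vz, readBit, glue, this, show 0 < n by omega]
  have key : ∀ s : Finset (Fin p), ∏ q ∈ s, had1 (x q) (y q) =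
      if ∑ q ∈ s, bz (x q) * bz (y q) = 1 then -1 else 1 := by
    intro s
    induction s using Finset.cons_induction with
    | empty => simp
    | cons q s hq ih =>
      rw [Finset.prod_cons, Finset.sum_cons, ih]
      generalize ∑ q ∈ s, bz (x q) * bz (y q) = z
      generalize x q = c
      generalize y q = e
      have hz : z = 0 ∨ z = 1 := by revert z; decide
      have h11 : (1 : ZMod 2) + 1 ≠ 1 := by decide
      rcases hz with rfl | rfl <;> cases c <;> cases e <;> simp [had1, bz]
  rw [had, key]
  simp only [ipFun, decide_eq_true_eq]
  rw [← Fin.sum_univ_eq_sum_range (fun q => vz (glue p n x y) q * vz (glue p n x y) (p + q))]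
  simp only [hx, hy]

lemma ip_lower {p n w k : ℕ} (hn : 2 * p ≤ n) (ε : ℝ)
    (h : quantComputes (k + 1) w n (Equiv.refl (Fin n)) ε (ipFun p n)) :
    ε * √(2 ^ p) ≤ (w : ℝ) ^ (2 * (k + 1)) + 1 / 2 := by
  obtain ⟨ψ0, G, A, hψ, hG, h1, h0⟩ := h
  have hF := had_fac ((fac_state hn ψ0 G hψ hG k).prob A)
  set P : (Fin p → Bool) → (Fin p → Bool) → ℝ := fun x y =>
    ∑ i ∈ A, Complex.normSq (quantState (Equiv.refl (Fin n)) ψ0 G (glue p n x y) ((k + 1) * n) i)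
    with hP
  have hF' : |∑ x, ∑ y, had x y * P x y| ≤ √(2 ^ p) * (2 ^ p * ((w : ℝ) ^ (k + 1)) ^ 2) := by
    have e : ∑ x, ∑ y, (had x y : ℂ) * ((P x y : ℝ) : ℂ) =
        ((∑ x, ∑ y, had x y * P x y : ℝ) : ℂ) := by
      push_cast
      rfl
    rw [← Real.norm_eq_abs, ← Complex.norm_real, ← e]
    exact hF
  have hC' : |∑ x : Fin p → Bool, ∑ y : Fin p → Bool, had x y| ≤ √(2 ^ p) * 2 ^ p := had_sum
  have hpt : ∀ x y, ε ≤ - (had x y * P x y) + 1 / 2 * had x y := by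
    intro x y
    rw [had_ip hn]
    split_ifs with hf
    · have := h1 _ hf
      simp only [hP]; linarith
    · have := h0 _ (by simpa using hf)
      simp only [hP]; linarith
  have hs := Finset.sum_le_sum fun x (_ : x ∈ (Finset.univ : Finset (Fin p → Bool))) =>
    Finset.sum_le_sum fun y (_ : y ∈ (Finset.univ : Finset (Fin p → Bool))) => hpt x y
  simp only [Finset.sum_add_distrib, Finset.sum_neg_distrib, ← Finset.mul_sum, Finset.sum_const,
    Finset.card_univ, Fintype.card_fun, Fintype.card_bool, Fintype.card_fin, nsmul_eq_mul] at hs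
  push_cast at hs
  have a1 := (abs_le.1 hF').1
  have a2 := (abs_le.1 hC').2
  have hr2 : √(2 ^ p : ℝ) ^ 2 = 2 ^ p := Real.sq_sqrt (by positivity)
  have hrpos : 0 < √(2 ^ p : ℝ) := Real.sqrt_pos.2 (by positivity)
  set r : ℝ := √(2 ^ p) with hr
  rw [← hr2] at a1 a2 hs
  have : r ^ 3 * (ε * r) ≤ r ^ 3 * ((w : ℝ) ^ (2 * (k + 1)) + 1 / 2) := by
    rw [mul_comm 2 (k + 1), pow_mul]
    nlinarith
  exact le_of_mul_le_mul_left this (by positivity)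

/-- Width hierarchy for quantum `k`-OBDDs with the natural (identity) order: for every
`ε ∈ (0, 1/2]` there is a constant `C₁ > 0` such that for all `k ≥ 4`, `d ≥ 24` with
`d ≥ C₁·k` and `n ≥ 2·k·d·⌈log₂ d⌉` there is a Boolean function computed exactly by a
quantum `k`-id-OBDD of width `d²` but not computed with error at most `1/2 - ε` by any
quantum `k`-id-OBDD of width `⌊√(d/(C₁·k))⌋`. -/
theorem quantum_kOBDD_width_hierarchy :
    ∀ ε : ℝ, 0 < ε → ε ≤ 1 / 2 →
    ∃ C₁ : ℝ, 0 < C₁ ∧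
      ∀ k d n : ℕ, 4 ≤ k → 24 ≤ d → C₁ * k ≤ (d : ℝ) →
        2 * k * d * Nat.clog 2 d ≤ n →
        ∃ f : (Fin n → Bool) → Bool,
          quantComputesExactly k (d ^ 2) n (Equiv.refl (Fin n)) f ∧
          ¬ quantComputes k ⌊Real.sqrt ((d : ℝ) / (C₁ * k))⌋₊ n (Equiv.refl (Fin n)) ε f := by
  intro ε hε hε2
  refine ⟨1 / ε, by positivity, ?_⟩
  intro k d n hk hd hC hn
  set L := Nat.log 2 d with hL
  have hL4 : 4 ≤ L := Nat.le_log_of_pow_le (by norm_num) (by norm_num; omega)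
  have hLle : 2 ^ L ≤ d := Nat.pow_log_le_self 2 (by omega)
  have hLgt : d < 2 ^ (L + 1) := Nat.lt_pow_succ_log_self (by norm_num) d
  obtain ⟨b, hb⟩ : ∃ b, 2 * L = b + 1 := ⟨2 * L - 1, by omega⟩
  have hn2 : 2 * (k * b) ≤ n := by
    refine le_trans ?_ hn
    have h1 : L ≤ Nat.clog 2 d := Nat.log_le_clog 2 d
    have h2 : b ≤ d * Nat.clog 2 d := by
      have : 2 * Nat.clog 2 d ≤ d * Nat.clog 2 d := Nat.mul_le_mul_right _ (by omega)
      omega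
    calc 2 * (k * b) ≤ 2 * (k * (d * Nat.clog 2 d)) := by gcongr
      _ = _ := by ring
  refine ⟨ipFun (k * b) n, ip_upper hn2 ?_, ?_⟩
  · rw [← hb, mul_comm, pow_mul]
    exact Nat.pow_le_pow_left hLle 2
  · intro h
    set w := ⌊Real.sqrt ((d : ℝ) / (1 / ε * k))⌋₊ with hw
    have hkpos : (0 : ℝ) < k := by exact_mod_cast (by omega : 0 < k)
    have hdpos : (0 : ℝ) < d := by exact_mod_cast (by omega : 0 < d)
    have hq : (d : ℝ) / (1 / ε * k) = d * ε / k := by field_simp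
    have hw1 : 1 ≤ w := by
      rw [hw, Nat.one_le_floor_iff, Real.one_le_sqrt]
      rw [one_le_div (by positivity)]
      exact hC
    have hw2 : (w : ℝ) ^ 2 ≤ d * ε / k := by
      have h1 : (w : ℝ) ≤ Real.sqrt ((d : ℝ) / (1 / ε * k)) := Nat.floor_le (Real.sqrt_nonneg _)
      rw [hq] at h1
      calc (w : ℝ) ^ 2 ≤ (Real.sqrt (d * ε / k)) ^ 2 := by gcongr
        _ = _ := Real.sq_sqrt (by positivity)
    obtain ⟨k', rfl⟩ : ∃ k', k = k' + 1 := ⟨k - 1, by omega⟩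
    have hlow := ip_lower hn2 ε h
    generalize hK : k' + 1 = K at *
    have hone : (1 : ℝ) ≤ (w : ℝ) ^ (2 * K) := one_le_pow₀ (by exact_mod_cast hw1)
    have h3 : ε * √(2 ^ (K * b)) ≤ 2 * (w : ℝ) ^ (2 * K) := by linarith
    have h4 : ε ^ 2 * 2 ^ (K * b) ≤ 4 * (d * ε / K) ^ (2 * K) := by
      calc ε ^ 2 * 2 ^ (K * b) = (ε * √(2 ^ (K * b))) ^ 2 := by
            rw [mul_pow, Real.sq_sqrt (by positivity)]
        _ ≤ (2 * (w : ℝ) ^ (2 * K)) ^ 2 := by gcongr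
        _ = 4 * ((w : ℝ) ^ 2) ^ (2 * K) := by ring
        _ ≤ _ := by gcongr
    have h5 : (d : ℝ) ^ 2 ≤ 8 * 2 ^ b := by
      have : d ^ 2 ≤ 8 * 2 ^ b := by
        calc d ^ 2 ≤ (2 ^ (L + 1)) ^ 2 := Nat.pow_le_pow_left hLgt.le 2
          _ = 2 ^ (2 * L) * 4 := by ring
          _ = 8 * 2 ^ b := by rw [hb]; ring
      exact_mod_cast this
    have h6 : (d : ℝ) ^ (2 * K) ≤ 8 ^ K * 2 ^ (K * b) := by
      calc (d : ℝ) ^ (2 * K) = ((d : ℝ) ^ 2) ^ K := by rw [pow_mul]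
        _ ≤ (8 * 2 ^ b) ^ K := by gcongr
        _ = _ := by rw [mul_pow, ← pow_mul, mul_comm b K]
    have h7 : ε ^ (2 * K) ≤ ε ^ 2 := pow_le_pow_of_le_one hε.le (by linarith) (by omega)
    have h8 : (16 : ℝ) ^ K ≤ (K : ℝ) ^ (2 * K) := by
      rw [pow_mul]
      have : (4 : ℝ) ≤ K := by exact_mod_cast hk
      gcongr
      nlinarith
    have h9 : (4 : ℝ) * 8 ^ K < 16 ^ K := by
      have : (16 : ℝ) ^ K = 2 ^ K * 8 ^ K := by rw [← mul_pow]; norm_num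
      rw [this]
      have h2K : (2 : ℝ) ^ 4 ≤ 2 ^ K := pow_le_pow_right₀ (by norm_num) hk
      have : (0 : ℝ) < 8 ^ K := by positivity
      nlinarith
    rw [div_pow, mul_pow, mul_div_assoc', le_div_iff₀ (by positivity)] at h4
    have hM : (0 : ℝ) < ε ^ 2 * 2 ^ (K * b) := by positivity
    have h10 : 4 * ((d : ℝ) ^ (2 * K) * ε ^ (2 * K)) ≤ ε ^ 2 * 2 ^ (K * b) * (4 * 8 ^ K) := by
      calc 4 * ((d : ℝ) ^ (2 * K) * ε ^ (2 * K)) ≤ 4 * (8 ^ K * 2 ^ (K * b) * ε ^ 2) := by gcongr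
        _ = _ := by ring
    have h11 := le_of_mul_le_mul_left (h4.trans h10) hM
    linarith
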